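/- arXiv:0803.0552 — 2 statements merged into one kernel-verified Lean document; each statement's English description precedes it below -/
import Mathlib

section
/- Let κ > 1/4 and let σ : ℝ → ℝ be twice continuously differentiable with σ, σ′, σ″ bounded. Then the composition (Nemytskii) operator y ↦ σ∘y satisfies: (i) there exists c > 0 such that W_κ(σ∘y) ≤ c (1 + W_κ(y)) for every continuous y : [0,1] → ℝ; (ii) it is locally Lipschitz for W_κ: for every R > 0 there exists L > 0 such that W_κ(σ∘y − σ∘y′) ≤ L · W_κ(y − y′) whenever y, y′ : [0,1] → ℝ are continuous with W_κ(y) ≤ R and W_κ(y′) ≤ R; (iii) it is globally Lipschitz in L²: ∫_0^1 |σ(y(ξ)) − σ(y′(ξ))|² dξ ≤ (sup|σ′|)² ∫_0^1 |y(ξ) − y′(ξ)|² dξ for all continuous y, y′. -/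
open MeasureTheory
open scoped ENNReal

/-- The (possibly infinite) fractional Sobolev norm
`W_κ(ψ) = (∫₀¹ ψ² + ∫₀¹∫₀¹ |ψ(ξ)−ψ(η)|²/|ξ−η|^{1+4κ})^{1/2}`. -/
noncomputable def Wnorm (κ : ℝ) (ψ : ℝ → ℝ) : ℝ≥0∞ :=
  ((∫⁻ ξ in Set.Icc (0 : ℝ) 1, ENNReal.ofReal (ψ ξ ^ 2)) +
      ∫⁻ q in Set.Icc (0 : ℝ) 1 ×ˢ Set.Icc (0 : ℝ) 1,
        ENNReal.ofReal ((ψ q.1 - ψ q.2) ^ 2 / |q.1 - q.2| ^ (1 + 4 * κ))) ^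
    (1 / 2 : ℝ)


/-- L² part of the squared norm. -/
noncomputable def Lsq (ψ : ℝ → ℝ) : ℝ≥0∞ :=
  ∫⁻ ξ in Set.Icc (0 : ℝ) 1, ENNReal.ofReal (ψ ξ ^ 2)

/-- Gagliardo part of the squared norm. -/
noncomputable def Ssq (κ : ℝ) (ψ : ℝ → ℝ) : ℝ≥0∞ :=
  ∫⁻ q in Set.Icc (0 : ℝ) 1 ×ˢ Set.Icc (0 : ℝ) 1,
        ENNReal.ofReal ((ψ q.1 - ψ q.2) ^ 2 / |q.1 - q.2| ^ (1 + 4 * κ))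

lemma Wnorm_eq (κ : ℝ) (ψ : ℝ → ℝ) : Wnorm κ ψ = (Lsq ψ + Ssq κ ψ) ^ (1 / 2 : ℝ) := rfl

lemma Wnorm_congr (κ : ℝ) {f g : ℝ → ℝ} (h : ∀ x ∈ Set.Icc (0 : ℝ) 1, f x = g x) :
    Wnorm κ f = Wnorm κ g := by
  unfold Wnorm
  congr 2
  · exact setLIntegral_congr_fun measurableSet_Icc (fun x hx => by simp only [h x hx])
  · exact setLIntegral_congr_fun (measurableSet_Icc.prod measurableSet_Icc)
      (fun q hq => by simp only [h _ hq.1, h _ hq.2])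

lemma cs_aux {α : Type*} [MeasurableSpace α] {μ : Measure α} [IsFiniteMeasure μ] {g : α → ℝ}
    (hg : Integrable g μ) (hg2 : Integrable (fun x => g x ^ 2) μ) {m : ℝ}
    (hm : μ.real Set.univ = m) (hm0 : 0 < m) :
    (∫ x, g x ∂μ) ^ 2 ≤ m * ∫ x, g x ^ 2 ∂μ := by
  set G := ∫ x, g x ∂μ with hG
  have h1 : ∫ x, (2 * (G / m) * g x - (G / m) ^ 2) ∂μ ≤ ∫ x, g x ^ 2 ∂μ := by
    apply integral_mono ((hg.const_mul _).sub (integrable_const _)) hg2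
    intro x
    change 2 * (G / m) * g x - (G / m) ^ 2 ≤ g x ^ 2
    nlinarith [sq_nonneg (g x - G / m)]
  rw [integral_sub (hg.const_mul _) (integrable_const _), integral_const_mul, integral_const, hm,
    ← hG] at h1
  have h2 : 2 * (G / m) * G - m • (G / m) ^ 2 = G ^ 2 / m := by
    simp only [smul_eq_mul]; field_simp; ring
  rw [h2, div_le_iff₀ hm0] at h1
  linarith

lemma step_aux {κ : ℝ} (hκ : 1 / 4 < κ) {f : ℝ → ℝ} (hf : Continuous f) {a h a' h' : ℝ}
    (h0' : 0 < h') (h0 : 0 < h)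
    (hI : Set.Icc a (a + h) ⊆ Set.Icc 0 1) (hI' : Set.Icc a' (a' + h') ⊆ Set.Icc a (a + h))
    (hS : Ssq κ f ≠ ⊤) :
    (h'⁻¹ * (∫ x in Set.Icc a' (a' + h'), f x) - h⁻¹ * ∫ x in Set.Icc a (a + h), f x) ^ 2 ≤
      h ^ (1 + 4 * κ) / (h * h') * (Ssq κ f).toReal := by
  set A' := ∫ x in Set.Icc a' (a' + h'), f x with hA'
  set A := ∫ x in Set.Icc a (a + h), f x with hA
  set I := Set.Icc a (a + h) with hIdef
  set I' := Set.Icc a' (a' + h') with hIdef'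
  have hp : (volume : Measure (ℝ × ℝ)).restrict (I' ×ˢ I) =
      (volume.restrict I').prod (volume.restrict I) := by
    rw [Measure.prod_restrict]; rfl
  have hcomp : IsCompact (I' ×ˢ I) := isCompact_Icc.prod isCompact_Icc
  have hfin : IsFiniteMeasure ((volume : Measure (ℝ × ℝ)).restrict (I' ×ˢ I)) := by
    rw [hp]; infer_instance
  have hint : ∀ g : ℝ × ℝ → ℝ, Continuous g → Integrable g (volume.restrict (I' ×ˢ I)) :=
    fun g hg => hg.continuousOn.integrableOn_compact hcomp
  have vI : (volume.restrict I).real Set.univ = h := by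
    simp [hIdef, h0.le]
  have vI' : (volume.restrict I').real Set.univ = h' := by
    simp [hIdef', h0'.le]
  have hm : ((volume : Measure (ℝ × ℝ)).restrict (I' ×ˢ I)).real Set.univ = h' * h := by
    rw [hp, ← Set.univ_prod_univ, measureReal_prod_prod, vI, vI']
  have hG : ∫ q in I' ×ˢ I, (f q.1 - f q.2) = h * A' - h' * A := by
    rw [integral_sub (hint _ (by fun_prop)) (hint _ (by fun_prop)), hp,
      integral_fun_fst, integral_fun_snd, vI, vI']
    rfl
  have hcs := cs_aux (hint (fun q => f q.1 - f q.2) (by fun_prop))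
    (hint (fun q => (f q.1 - f q.2) ^ 2) (by fun_prop)) hm (by positivity)
  rw [hG] at hcs
  have hle : ∫ q in I' ×ˢ I, (f q.1 - f q.2) ^ 2 ≤ h ^ (1 + 4 * κ) * (Ssq κ f).toReal := by
    rw [← ENNReal.ofReal_le_ofReal_iff (by positivity), ENNReal.ofReal_mul (by positivity),
      ENNReal.ofReal_toReal hS, ofReal_integral_eq_lintegral_ofReal (hint _ (by fun_prop))
        (Filter.Eventually.of_forall fun q => by positivity)]
    rw [Ssq, ← lintegral_const_mul' _ _ ENNReal.ofReal_ne_top]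
    calc ∫⁻ q in I' ×ˢ I, ENNReal.ofReal ((f q.1 - f q.2) ^ 2)
        ≤ ∫⁻ q in I' ×ˢ I, ENNReal.ofReal (h ^ (1 + 4 * κ)) *
          ENNReal.ofReal ((f q.1 - f q.2) ^ 2 / |q.1 - q.2| ^ (1 + 4 * κ)) := by
          apply setLIntegral_mono' (measurableSet_Icc.prod measurableSet_Icc)
          rintro ⟨u, v⟩ ⟨hu, hv⟩
          rw [← ENNReal.ofReal_mul (by positivity)]
          apply ENNReal.ofReal_le_ofReal
          simp only at hu hv ⊢
          have hu2 := hI' hu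
          rcases eq_or_ne u v with rfl | huv
          · simp
          · have hpos : 0 < |u - v| := abs_pos.2 (sub_ne_zero.2 huv)
            have hb : |u - v| ≤ h := by
              rw [abs_le]; constructor <;> linarith [hu2.1, hu2.2, hv.1, hv.2]
            have hr : |u - v| ^ (1 + 4 * κ) ≤ h ^ (1 + 4 * κ) :=
              Real.rpow_le_rpow hpos.le hb (by linarith)
            rw [← mul_div_assoc, le_div_iff₀ (by positivity), mul_comm]
            gcongr
      _ ≤ _ := lintegral_mono_set (Set.prod_mono (hI'.trans hI) hI)
  have e : (h'⁻¹ * A' - h⁻¹ * A) = (h * A' - h' * A) / (h * h') := by field_simp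
  rw [e, div_pow, div_le_iff₀ (by positivity)]
  calc _ ≤ _ := hcs
    _ ≤ h' * h * (h ^ (1 + 4 * κ) * (Ssq κ f).toReal) := by gcongr
    _ = _ := by field_simp

lemma sob {κ : ℝ} (hκ : 1 / 4 < κ) : ∃ C : ℝ, 0 < C ∧ ∀ f : ℝ → ℝ, Continuous f →
    Lsq f + Ssq κ f ≠ ⊤ → ∀ x ∈ Set.Icc (0 : ℝ) 1,
      f x ^ 2 ≤ C * (Lsq f + Ssq κ f).toReal := by
  set r : ℝ := (1 / 2 : ℝ) ^ ((4 * κ - 1) / 2) with hr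
  have hr0 : 0 < r := by positivity
  have hr1 : r < 1 := Real.rpow_lt_one (by norm_num) (by norm_num) (by linarith)
  have hr2 : r ^ 2 = (1 / 2 : ℝ) ^ (4 * κ - 1) := by
    rw [hr, ← Real.rpow_natCast, ← Real.rpow_mul (by norm_num)]; congr 1; push_cast; ring
  have h1r : 0 < 1 - r := by linarith
  refine ⟨(1 + √2 / (1 - r)) ^ 2, by positivity, ?_⟩
  intro f hf hfin x hx
  have hLt : Lsq f ≠ ⊤ := fun h => hfin (by simp [h])
  have hSt : Ssq κ f ≠ ⊤ := fun h => hfin (by simp [h])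
  set W := (Lsq f + Ssq κ f).toReal with hW
  have hWeq : W = (Lsq f).toReal + (Ssq κ f).toReal := ENNReal.toReal_add hLt hSt
  have hL0 : 0 ≤ (Lsq f).toReal := ENNReal.toReal_nonneg
  have hS0 : 0 ≤ (Ssq κ f).toReal := ENNReal.toReal_nonneg
  have hW0 : 0 ≤ W := ENNReal.toReal_nonneg
  let h : ℕ → ℝ := fun n => (1 / 2) ^ n
  have hh0 : ∀ n, 0 < h n := fun n => by positivity
  have hh1 : ∀ n, h n ≤ 1 := fun n => pow_le_one₀ (by norm_num) (by norm_num)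
  let a : ℕ → ℝ := fun n => x - h n * x
  let A : ℕ → ℝ := fun n => (h n)⁻¹ * ∫ t in Set.Icc (a n) (a n + h n), f t
  have hstep : ∀ n, dist (A n) (A (n + 1)) ≤ √2 * √W * r ^ n := by
    intro n
    have hs : h (n + 1) = h n / 2 := by simp only [h, pow_succ]; ring
    have key := step_aux hκ hf (a := a n) (h := h n) (a' := a (n + 1)) (h' := h (n + 1))
      (hh0 _) (hh0 _) (by
        apply Set.Icc_subset_Icc
        · simp only [a]; nlinarith [hh1 n, hh0 n, hx.1, hx.2]
        · simp only [a]; nlinarith [hh1 n, hh0 n, hx.1, hx.2]) (by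
        apply Set.Icc_subset_Icc
        · simp only [a, hs]; nlinarith [hh1 n, hh0 n, hx.1, hx.2]
        · simp only [a, hs]; nlinarith [hh1 n, hh0 n, hx.1, hx.2]) hSt
    have e : (h n) ^ (1 + 4 * κ) / (h n * h (n + 1)) = 2 * (r ^ n) ^ 2 := by
      rw [hs]
      have e1 : (r ^ n) ^ 2 = (h n) ^ (4 * κ - 1) := by
        rw [← pow_mul, mul_comm, pow_mul, hr2]
        simp only [h]
        rw [← Real.rpow_natCast, ← Real.rpow_natCast, ← Real.rpow_mul (by norm_num),
          ← Real.rpow_mul (by norm_num), mul_comm]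
      rw [e1, show (1 + 4 * κ) = (4 * κ - 1) + (2 : ℕ) by push_cast; ring,
        Real.rpow_add_natCast (hh0 n).ne']
      have := hh0 n
      field_simp
    rw [e] at key
    rw [dist_comm, Real.dist_eq]
    apply abs_le_of_sq_le_sq _ (by positivity)
    calc _ ≤ _ := key
      _ ≤ 2 * (r ^ n) ^ 2 * W := by gcongr; linarith
      _ = _ := by
        rw [mul_pow, mul_pow, Real.sq_sqrt hW0, Real.sq_sqrt (by norm_num)]; ring
  have htend : Filter.Tendsto A Filter.atTop (nhds (f x)) := by
    rw [Metric.tendsto_atTop]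
    intro ε hε
    obtain ⟨δ, hδ, hfd⟩ := Metric.continuous_iff.1 hf x (ε / 2) (by positivity)
    obtain ⟨N, hN⟩ := exists_pow_lt_of_lt_one hδ (show (1 / 2 : ℝ) < 1 by norm_num)
    refine ⟨N, fun n hn => ?_⟩
    have hhn : h n < δ := lt_of_le_of_lt
      (pow_le_pow_of_le_one (by norm_num) (by norm_num) hn) hN
    have hc : ∫ t in Set.Icc (a n) (a n + h n), (f t - f x) = h n * A n - h n * f x := by
      rw [integral_sub (hf.continuousOn.integrableOn_compact isCompact_Icc)
        (continuousOn_const.integrableOn_compact isCompact_Icc)]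
      have := (hh0 n).ne'
      simp only [A]
      rw [mul_inv_cancel_left₀ this]
      simp [(hh0 n).le]
    have hb : ‖∫ t in Set.Icc (a n) (a n + h n), (f t - f x)‖ ≤
        ε / 2 * volume.real (Set.Icc (a n) (a n + h n)) := by
      apply norm_setIntegral_le_of_norm_le_const (by simp)
      intro t ht
      have := hfd t (by
        rw [Real.dist_eq, abs_lt]
        simp only [a] at ht
        constructor <;> nlinarith [ht.1, ht.2, hh0 n, hx.1, hx.2])
      rw [Real.dist_eq] at this
      exact this.le
    have hv : volume.real (Set.Icc (a n) (a n + h n)) = h n := by simp [(hh0 n).le]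
    rw [hc, hv, ← mul_sub, norm_mul, Real.norm_of_nonneg (hh0 n).le, mul_comm,
      mul_le_mul_iff_left₀ (hh0 n)] at hb
    rw [dist_eq_norm]; linarith
  have hd := dist_le_of_le_geometric_of_tendsto₀ r (√2 * √W) hr1 hstep htend
  have hA0 : |A 0| ≤ √W := by
    apply Real.abs_le_sqrt
    have hA0' : A 0 = ∫ t in Set.Icc (0 : ℝ) 1, f t := by simp [A, a, h]
    have := cs_aux (μ := volume.restrict (Set.Icc (0 : ℝ) 1)) (g := f) (m := 1)
      (hf.continuousOn.integrableOn_compact isCompact_Icc)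
      ((hf.pow 2).continuousOn.integrableOn_compact isCompact_Icc) (by simp) one_pos
    rw [hA0']
    have e : ∫ t in Set.Icc (0 : ℝ) 1, f t ^ 2 = (Lsq f).toReal := by
      rw [Lsq, integral_eq_lintegral_of_nonneg_ae
        (Filter.Eventually.of_forall fun q => sq_nonneg (f q))
        (by fun_prop)]
    rw [e] at this
    linarith
  have hfx : |f x| ≤ (1 + √2 / (1 - r)) * √W := by
    rw [Real.dist_eq] at hd
    have h3 : |f x| ≤ |A 0| + |A 0 - f x| := by
      have := abs_sub (A 0) (A 0 - f x)
      simpa using this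
    calc |f x| ≤ √W + √2 * √W / (1 - r) := by linarith
      _ = _ := by ring
  rw [← sq_abs]
  calc |f x| ^ 2 ≤ ((1 + √2 / (1 - r)) * √W) ^ 2 := by gcongr
    _ = _ := by rw [mul_pow, Real.sq_sqrt hW0]

lemma lip_sq {g : ℝ → ℝ} (hg : Differentiable ℝ g) {K : ℝ} (hK : ∀ x, |deriv g x| ≤ K)
    (x y : ℝ) : (g x - g y) ^ 2 ≤ K ^ 2 * (x - y) ^ 2 := by
  have h := Convex.norm_image_sub_le_of_norm_deriv_le (f := g) (s := Set.univ) (C := K)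
    (fun x _ => hg x) (fun x _ => hK x) convex_univ (Set.mem_univ y) (Set.mem_univ x)
  rw [Real.norm_eq_abs, Real.norm_eq_abs] at h
  rw [← sq_abs (g x - g y), ← sq_abs (x - y), ← mul_pow]
  gcongr

lemma four_pt {σ : ℝ → ℝ} (hσ : ContDiff ℝ 2 σ) {K₁ K₂ : ℝ}
    (h1 : ∀ x : ℝ, |deriv σ x| ≤ K₁) (h2 : ∀ x : ℝ, |deriv (deriv σ) x| ≤ K₂)
    (a b c d : ℝ) :
    (σ a - σ b - (σ c - σ d)) ^ 2 ≤ 2 * K₁ ^ 2 * ((a - b) - (c - d)) ^ 2 +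
      2 * K₂ ^ 2 * (c - d) ^ 2 * ((a - c) ^ 2 + (b - d) ^ 2) := by
  have hd : Differentiable ℝ σ := hσ.differentiable (by norm_num)
  have hd' : Differentiable ℝ (deriv σ) :=
    ((contDiff_succ_iff_deriv (n := 1)).1 (by simpa [one_add_one_eq_two] using hσ)).2.2.differentiable
      (by norm_num)
  let g : ℝ → ℝ := fun t => σ (b + t * (a - b)) - σ (d + t * (c - d))
  let g' : ℝ → ℝ := fun t => deriv σ (b + t * (a - b)) * (a - b) -
    deriv σ (d + t * (c - d)) * (c - d)
  have hg : ∀ t, HasDerivAt g (g' t) t := by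
    intro t
    have aux : ∀ p q : ℝ, HasDerivAt (fun t : ℝ => σ (p + t * q)) (deriv σ (p + t * q) * q) t := by
      intro p q
      have hin : HasDerivAt (fun t : ℝ => p + t * q) q t := by
        simpa using ((hasDerivAt_id t).mul_const q).const_add p
      exact HasDerivAt.comp t (hd _).hasDerivAt hin
    exact (aux _ _).sub (aux _ _)
  obtain ⟨θ, hθ, he⟩ := exists_hasDerivAt_eq_slope g g' zero_lt_one
    (fun t _ => (hg t).continuousAt.continuousWithinAt) (fun t _ => hg t)
  have he2 : σ a - σ b - (σ c - σ d) = g' θ := by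
    rw [he]; simp only [g]; simp; ring
  set p := b + θ * (a - b) with hp
  set q := d + θ * (c - d) with hq
  have he3 : g' θ = deriv σ p * ((a - b) - (c - d)) + (deriv σ p - deriv σ q) * (c - d) := by
    simp only [g']; ring
  have hl := lip_sq hd' h2 p q
  have hpq : (p - q) ^ 2 ≤ (a - c) ^ 2 + (b - d) ^ 2 := by
    have : p - q = (1 - θ) * (b - d) + θ * (a - c) := by rw [hp, hq]; ring
    rw [this]
    have h3 : 0 ≤ θ * (1 - θ) := mul_nonneg hθ.1.le (by linarith [hθ.2])
    have h4 : ((1 - θ) * (b - d) + θ * (a - c)) ^ 2 =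
      (1 - θ) * (b - d) ^ 2 + θ * (a - c) ^ 2 - θ * (1 - θ) * ((b - d) - (a - c)) ^ 2 := by ring
    rw [h4]
    nlinarith [mul_nonneg h3 (sq_nonneg ((b - d) - (a - c))), mul_nonneg hθ.1.le (sq_nonneg (b - d)),
      mul_nonneg (sub_nonneg.2 hθ.2.le) (sq_nonneg (a - c))]
  have hs1 : (deriv σ p) ^ 2 ≤ K₁ ^ 2 := by
    rw [← sq_abs]; exact pow_le_pow_left₀ (abs_nonneg _) (h1 p) 2
  rw [he2, he3]
  calc _ ≤ 2 * (deriv σ p * ((a - b) - (c - d))) ^ 2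
        + 2 * ((deriv σ p - deriv σ q) * (c - d)) ^ 2 := by
        nlinarith [sq_nonneg (deriv σ p * ((a - b) - (c - d)) - (deriv σ p - deriv σ q) * (c - d))]
    _ = 2 * (deriv σ p) ^ 2 * ((a - b) - (c - d)) ^ 2
        + 2 * (deriv σ p - deriv σ q) ^ 2 * (c - d) ^ 2 := by ring
    _ ≤ 2 * K₁ ^ 2 * ((a - b) - (c - d)) ^ 2
        + 2 * (K₂ ^ 2 * ((a - c) ^ 2 + (b - d) ^ 2)) * (c - d) ^ 2 := by
        gcongr
        exact hl.trans (by gcongr)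
    _ = _ := by ring

lemma ofReal_sqrt_sq {M : ℝ} (hM : 0 ≤ M) :
    ENNReal.ofReal M ^ (1 / 2 : ℝ) = ENNReal.ofReal (√M) := by
  rw [ENNReal.ofReal_rpow_of_nonneg hM (by norm_num), Real.sqrt_eq_rpow]

lemma Lsq_le {f g : ℝ → ℝ} {M : ℝ} (hM : 0 ≤ M)
    (h : ∀ x ∈ Set.Icc (0 : ℝ) 1, f x ^ 2 ≤ M * g x ^ 2) :
    Lsq f ≤ ENNReal.ofReal M * Lsq g := by
  rw [Lsq, Lsq, ← lintegral_const_mul' _ _ ENNReal.ofReal_ne_top]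
  apply setLIntegral_mono' measurableSet_Icc
  intro x hx
  rw [← ENNReal.ofReal_mul hM]
  exact ENNReal.ofReal_le_ofReal (h x hx)

lemma part1 {κ : ℝ} {σ : ℝ → ℝ} (hσ : Differentiable ℝ σ) {K₀ K₁ : ℝ}
    (h0 : ∀ x : ℝ, |σ x| ≤ K₀) (h1 : ∀ x : ℝ, |deriv σ x| ≤ K₁) (y : ℝ → ℝ) :
    Wnorm κ (fun ξ => σ (y ξ)) ≤ ENNReal.ofReal (√(K₀ ^ 2 + K₁ ^ 2 + 1)) * (1 + Wnorm κ y) := by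
  set M := K₀ ^ 2 + K₁ ^ 2 + 1 with hM
  have hM0 : 0 ≤ M := by positivity
  have hL : Lsq (fun ξ => σ (y ξ)) ≤ ENNReal.ofReal M * 1 := by
    have := Lsq_le (f := fun ξ => σ (y ξ)) (g := fun _ => 1) hM0 (fun x _ => by
      have : σ (y x) ^ 2 ≤ K₀ ^ 2 := by
        rw [← sq_abs]; exact pow_le_pow_left₀ (abs_nonneg _) (h0 _) 2
      simp only [hM]
      nlinarith [sq_nonneg K₁])
    refine this.trans (le_of_eq ?_)
    simp [Lsq]
  have hS : Ssq κ (fun ξ => σ (y ξ)) ≤ ENNReal.ofReal M * Ssq κ y := by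
    rw [Ssq, Ssq, ← lintegral_const_mul' _ _ ENNReal.ofReal_ne_top]
    apply lintegral_mono
    intro q
    simp only
    rw [← ENNReal.ofReal_mul hM0]
    apply ENNReal.ofReal_le_ofReal
    rw [← mul_div_assoc]
    gcongr
    refine (lip_sq hσ h1 _ _).trans ?_
    gcongr
    rw [hM]; nlinarith [sq_nonneg K₀]
  rw [Wnorm_eq, Wnorm_eq, ← ofReal_sqrt_sq hM0]
  calc (Lsq (fun ξ => σ (y ξ)) + Ssq κ (fun ξ => σ (y ξ))) ^ (1 / 2 : ℝ)
      ≤ (ENNReal.ofReal M * (1 + (Lsq y + Ssq κ y))) ^ (1 / 2 : ℝ) := by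
        gcongr
        rw [mul_add]
        gcongr
        exact hS.trans (by gcongr; exact le_add_self)
    _ = ENNReal.ofReal M ^ (1 / 2 : ℝ) * (1 + (Lsq y + Ssq κ y)) ^ (1 / 2 : ℝ) :=
        ENNReal.mul_rpow_of_nonneg _ _ (by norm_num)
    _ ≤ _ := by
        gcongr
        refine (ENNReal.rpow_add_le_add_rpow _ _ (by norm_num) (by norm_num)).trans ?_
        simp

lemma part2 {κ : ℝ} (hκ : 1 / 4 < κ) {σ : ℝ → ℝ} (hσ : ContDiff ℝ 2 σ) {K₁ K₂ : ℝ}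
    (h1 : ∀ x : ℝ, |deriv σ x| ≤ K₁) (h2 : ∀ x : ℝ, |deriv (deriv σ) x| ≤ K₂)
    (R : ℝ) (hR : 0 < R) : ∃ L : ℝ, 0 < L ∧ ∀ y y' : ℝ → ℝ,
      Continuous y → Continuous y' →
      Wnorm κ y ≤ ENNReal.ofReal R → Wnorm κ y' ≤ ENNReal.ofReal R →
      Wnorm κ (fun ξ => σ (y ξ) - σ (y' ξ)) ≤
        ENNReal.ofReal L * Wnorm κ (fun ξ => y ξ - y' ξ) := by
  obtain ⟨C, hC, hsob⟩ := sob hκ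
  set M := 2 * K₁ ^ 2 + 2 * K₂ ^ 2 * C * (R ^ 2 + R ^ 2) + 1 with hM
  have hM0 : 0 < M := by positivity
  refine ⟨√M, by positivity, ?_⟩
  intro y y' hy hy' hyR hyR'
  set d : ℝ → ℝ := fun ξ => y ξ - y' ξ with hd
  have hdc : Continuous d := hy.sub hy'
  have hdiff : Differentiable ℝ σ := hσ.differentiable (by norm_num)
  have hSR : ∀ z : ℝ → ℝ, Wnorm κ z ≤ ENNReal.ofReal R → Ssq κ z ≤ ENNReal.ofReal (R ^ 2) := by
    intro z hz
    rw [Wnorm_eq] at hz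
    have h3 := ENNReal.rpow_le_rpow hz (show (0 : ℝ) ≤ 2 by norm_num)
    rw [← ENNReal.rpow_mul] at h3
    norm_num at h3
    rw [ENNReal.ofReal_pow hR.le]
    exact le_add_self.trans h3
  rw [Wnorm_eq, Wnorm_eq, ← ofReal_sqrt_sq hM0.le,
    ← ENNReal.mul_rpow_of_nonneg _ _ (by norm_num)]
  apply ENNReal.rpow_le_rpow _ (by norm_num)
  by_cases htop : Lsq d + Ssq κ d = ⊤
  · rw [htop, ENNReal.mul_top (by simpa using hM0)]; exact le_top
  have hs := hsob d hdc htop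
  set w := (Lsq d + Ssq κ d).toReal with hw
  have hw0 : 0 ≤ w := ENNReal.toReal_nonneg
  have hwe : ENNReal.ofReal w = Lsq d + Ssq κ d := ENNReal.ofReal_toReal htop
  have hL : Lsq (fun ξ => σ (y ξ) - σ (y' ξ)) ≤ ENNReal.ofReal (2 * K₁ ^ 2) * Lsq d := by
    apply Lsq_le (by positivity)
    intro x _
    refine (lip_sq hdiff h1 _ _).trans ?_
    simp only [hd]
    nlinarith [mul_nonneg (sq_nonneg K₁) (sq_nonneg (y x - y' x))]
  set N := 2 * K₂ ^ 2 * (C * w) with hN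
  have hN0 : 0 ≤ N := by positivity
  have hmeas : ∀ (c : ℝ) (z : ℝ → ℝ), Continuous z → Measurable (fun q : ℝ × ℝ =>
      ENNReal.ofReal c *
        ENNReal.ofReal ((z q.1 - z q.2) ^ 2 / |q.1 - q.2| ^ (1 + 4 * κ))) := by
    intro c z hz
    have := hz.measurable
    fun_prop
  have hS : Ssq κ (fun ξ => σ (y ξ) - σ (y' ξ)) ≤ ENNReal.ofReal (2 * K₁ ^ 2) * Ssq κ d +
      (ENNReal.ofReal N * Ssq κ y + ENNReal.ofReal N * Ssq κ y') := by
    simp only [Ssq]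
    rw [← lintegral_const_mul' _ _ ENNReal.ofReal_ne_top,
      ← lintegral_const_mul' _ _ ENNReal.ofReal_ne_top,
      ← lintegral_const_mul' _ _ ENNReal.ofReal_ne_top,
      ← lintegral_add_left (hmeas _ _ hy), ← lintegral_add_left (hmeas _ _ hdc)]
    apply setLIntegral_mono' (measurableSet_Icc.prod measurableSet_Icc)
    rintro ⟨u, v⟩ ⟨hu, hv⟩
    simp only at hu hv ⊢
    rw [← ENNReal.ofReal_mul (by positivity), ← ENNReal.ofReal_mul hN0,
      ← ENNReal.ofReal_mul hN0, ← ENNReal.ofReal_add (by positivity) (by positivity),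
      ← ENNReal.ofReal_add (by positivity) (by positivity)]
    apply ENNReal.ofReal_le_ofReal
    rw [← mul_div_assoc, ← mul_div_assoc, ← mul_div_assoc, ← add_div, ← add_div]
    gcongr
    refine (four_pt hσ h1 h2 (y u) (y' u) (y v) (y' v)).trans ?_
    have h4 : (y v - y' v) ^ 2 ≤ C * w := hs v hv
    rw [← mul_add, hN]
    simp only [hd]
    gcongr
  calc Lsq (fun ξ => σ (y ξ) - σ (y' ξ)) + Ssq κ (fun ξ => σ (y ξ) - σ (y' ξ))
      ≤ ENNReal.ofReal (2 * K₁ ^ 2) * Lsq d + (ENNReal.ofReal (2 * K₁ ^ 2) * Ssq κ d +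
      (ENNReal.ofReal N * ENNReal.ofReal (R ^ 2) + ENNReal.ofReal N * ENNReal.ofReal (R ^ 2))) := by
        refine add_le_add hL (hS.trans ?_)
        gcongr
        · exact hSR y hyR
        · exact hSR y' hyR'
    _ = ENNReal.ofReal (2 * K₁ ^ 2 * w + (N * R ^ 2 + N * R ^ 2)) := by
        rw [← add_assoc, ← mul_add, ← hwe, ← ENNReal.ofReal_mul (by positivity),
          ← ENNReal.ofReal_mul hN0, ← ENNReal.ofReal_add (by positivity) (by positivity),
          ← ENNReal.ofReal_add (by positivity) (by positivity)]
    _ ≤ ENNReal.ofReal (M * w) := by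
        apply ENNReal.ofReal_le_ofReal
        rw [hM, hN]
        nlinarith
    _ = _ := by rw [ENNReal.ofReal_mul hM0.le, hwe]

lemma exists_ext {y : ℝ → ℝ} (hy : ContinuousOn y (Set.Icc 0 1)) :
    ∃ z : ℝ → ℝ, Continuous z ∧ ∀ x ∈ Set.Icc (0 : ℝ) 1, y x = z x := by
  refine ⟨Set.IccExtend (zero_le_one' ℝ) (Set.restrict (Set.Icc 0 1) y), ?_, ?_⟩
  · exact (continuousOn_iff_continuous_restrict.1 hy).Icc_extend'
  · intro x hx
    rw [Set.IccExtend_of_mem _ _ hx]; rfl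

/-- For `κ > 1/4` and `σ ∈ C_b²(ℝ)`, the Nemytskii operator `y ↦ σ ∘ y`
(i) has linear growth for `W_κ`, (ii) is locally Lipschitz for `W_κ`, and
(iii) is globally Lipschitz in `L²(0,1)` with constant `sup |σ'|`. -/
theorem stmt18 (κ : ℝ) (hκ : 1 / 4 < κ) (σ : ℝ → ℝ) (hσ : ContDiff ℝ 2 σ)
    (hσb : ∃ K : ℝ, ∀ x : ℝ, |σ x| ≤ K)
    (hσ'b : ∃ K : ℝ, ∀ x : ℝ, |deriv σ x| ≤ K)
    (hσ''b : ∃ K : ℝ, ∀ x : ℝ, |deriv (deriv σ) x| ≤ K) :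
    (∃ c : ℝ, 0 < c ∧ ∀ y : ℝ → ℝ, ContinuousOn y (Set.Icc 0 1) →
      Wnorm κ (fun ξ => σ (y ξ)) ≤ ENNReal.ofReal c * (1 + Wnorm κ y)) ∧
    (∀ R : ℝ, 0 < R → ∃ L : ℝ, 0 < L ∧ ∀ y y' : ℝ → ℝ,
      ContinuousOn y (Set.Icc 0 1) → ContinuousOn y' (Set.Icc 0 1) →
      Wnorm κ y ≤ ENNReal.ofReal R → Wnorm κ y' ≤ ENNReal.ofReal R →
      Wnorm κ (fun ξ => σ (y ξ) - σ (y' ξ)) ≤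
        ENNReal.ofReal L * Wnorm κ (fun ξ => y ξ - y' ξ)) ∧
    (∀ K : ℝ, (∀ x : ℝ, |deriv σ x| ≤ K) → ∀ y y' : ℝ → ℝ,
      ContinuousOn y (Set.Icc 0 1) → ContinuousOn y' (Set.Icc 0 1) →
      (∫ ξ in Set.Icc (0 : ℝ) 1, (σ (y ξ) - σ (y' ξ)) ^ 2) ≤
        K ^ 2 * ∫ ξ in Set.Icc (0 : ℝ) 1, (y ξ - y' ξ) ^ 2) := by
  obtain ⟨K₀, h0⟩ := hσb
  obtain ⟨K₁, h1⟩ := hσ'b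
  obtain ⟨K₂, h2⟩ := hσ''b
  have hdiff : Differentiable ℝ σ := hσ.differentiable (by norm_num)
  refine ⟨⟨√(K₀ ^ 2 + K₁ ^ 2 + 1), by positivity, fun y _ => part1 hdiff h0 h1 y⟩, ?_, ?_⟩
  · intro R hR
    obtain ⟨L, hL, H⟩ := part2 hκ hσ h1 h2 R hR
    refine ⟨L, hL, fun y y' hy hy' hyR hyR' => ?_⟩
    obtain ⟨z, hz, hyz⟩ := exists_ext hy
    obtain ⟨z', hz', hyz'⟩ := exists_ext hy'
    rw [Wnorm_congr κ hyz] at hyR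
    rw [Wnorm_congr κ hyz'] at hyR'
    have h3 := H z z' hz hz' hyR hyR'
    rw [Wnorm_congr κ (f := fun ξ => σ (y ξ) - σ (y' ξ)) (g := fun ξ => σ (z ξ) - σ (z' ξ))
        (fun x hx => by simp only [hyz x hx, hyz' x hx]),
      Wnorm_congr κ (f := fun ξ => y ξ - y' ξ) (g := fun ξ => z ξ - z' ξ)
        (fun x hx => by simp only [hyz x hx, hyz' x hx])]
    exact h3
  · intro K hK y y' hy hy'
    rw [← integral_const_mul]
    apply setIntegral_mono_on _ _ measurableSet_Icc (fun x _ => lip_sq hdiff hK _ _)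
    · exact (((hσ.continuous.comp_continuousOn hy).sub
        (hσ.continuous.comp_continuousOn hy')).pow 2).integrableOn_compact isCompact_Icc
    · exact (continuousOn_const.mul ((hy.sub hy').pow 2)).integrableOn_compact isCompact_Icc
end

section
/- Let η > 1/4, 0 < ν < 2η and ε > 0, and set a := 1/2 + 2η − ν + ε. Then there exists a constant C > 0 (depending only on η, ν, ε) such that for every τ ∈ (0,1], the sum Σ over all (i,j,k,l) ∈ ℤ⁴ with i + j + k + l = 0 of λ_i^{2η} λ_j^{−ν} λ_k^{−2η} λ_l^{−2η} e^{−2λ_i τ} is finite and bounded by C τ^{−a}. -/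
/-- The eigenvalues `λ_n = 1 + (2πn)²` of `Id − Δ` on the circle. -/
noncomputable def lam (n : ℤ) : ℝ := 1 + (2 * Real.pi * (n : ℝ)) ^ 2

lemma one_le_lam (n : ℤ) : 1 ≤ lam n := by
  unfold lam; nlinarith [sq_nonneg (2 * Real.pi * (n : ℝ))]

lemma lam_pos (n : ℤ) : 0 < lam n := lt_of_lt_of_le one_pos (one_le_lam n)

lemma sq_le_lam (n : ℤ) : |(n : ℝ)| ^ (2 : ℝ) ≤ lam n := by
  have h : |(n : ℝ)| ^ (2 : ℝ) = (n : ℝ) ^ 2 := by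
    rw [Real.rpow_two, sq_abs]
  rw [h]; unfold lam
  have h1 : (1 : ℝ) ≤ (2 * Real.pi) ^ 2 := by nlinarith [Real.pi_gt_three]
  rw [mul_pow]
  nlinarith [sq_nonneg (n : ℝ)]

lemma summable_lam (s : ℝ) (hs : 1 / 2 < s) : Summable (fun n : ℤ => lam n ^ (-s)) := by
  have h1 : Summable (fun n : ℤ => |(n : ℝ)| ^ (-(2 * s))) :=
    Real.summable_abs_int_rpow (by linarith)
  have h2 : Summable (fun n : ℤ => if n = 0 then (1 : ℝ) else 0) :=
    (hasSum_ite_eq (0 : ℤ) (1 : ℝ)).summable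
  refine Summable.of_nonneg_of_le (fun n => (Real.rpow_pos_of_pos (lam_pos n) _).le) ?_
    (h1.add h2)
  intro n
  by_cases hn : n = 0
  · have : lam n ^ (-s) ≤ 1 := Real.rpow_le_one_of_one_le_of_nonpos (one_le_lam n) (by linarith)
    have h3 : 0 ≤ |(n : ℝ)| ^ (-(2 * s)) := Real.rpow_nonneg (abs_nonneg _) _
    rw [if_pos hn]; linarith
  · rw [if_neg hn, add_zero]
    have hp : 0 < |(n : ℝ)| := abs_pos.mpr (by exact_mod_cast hn)
    have : |(n : ℝ)| ^ (-(2 * s)) = (|(n : ℝ)| ^ (2 : ℝ)) ^ (-s) := by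
      rw [← Real.rpow_mul hp.le]; congr 1; ring
    rw [this]
    exact Real.rpow_le_rpow_of_nonpos (Real.rpow_pos_of_pos hp _) (sq_le_lam n) (by linarith)

lemma lam_sum_le (i k l : ℤ) : lam i ≤ 3 * (lam (-i - k - l) + lam k + lam l) := by
  unfold lam
  push_cast
  have : (i : ℝ) = -((-i - k - l : ℝ) + k + l) := by ring
  set j : ℝ := (-i - k - l : ℝ)
  rw [this]
  have hp : 0 ≤ (2 * Real.pi) ^ 2 := sq_nonneg _
  have h : (j + k + l) ^ 2 ≤ 3 * (j ^ 2 + (k : ℝ) ^ 2 + (l : ℝ) ^ 2) := by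
    nlinarith [sq_nonneg (j - k), sq_nonneg (j - l), sq_nonneg ((k : ℝ) - l)]
  have h2 := mul_le_mul_of_nonneg_left h hp
  simp only [mul_pow, neg_sq] at h2 ⊢
  linarith

/-- Interpolation between two negative powers. -/
lemma young (x y p q : ℝ) (hx : 1 ≤ x) (hy : 1 ≤ y) (hp : 0 ≤ p) (hq : 0 ≤ q) :
    x ^ (-p) * y ^ (-q) ≤ x ^ (-(p + q)) + y ^ (-(p + q)) := by
  have hx0 : 0 < x := by linarith
  have hy0 : 0 < y := by linarith
  have h1 := Real.rpow_pos_of_pos hx0 (-(p + q))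
  have h2 := Real.rpow_pos_of_pos hy0 (-(p + q))
  rcases le_total x y with h | h
  · have : y ^ (-q) ≤ x ^ (-q) := Real.rpow_le_rpow_of_nonpos hx0 h (by linarith)
    have h3 := mul_le_mul_of_nonneg_left this (Real.rpow_pos_of_pos hx0 (-p)).le
    rw [← Real.rpow_add hx0, show -p + -q = -(p + q) by ring] at h3
    linarith
  · have : x ^ (-p) ≤ y ^ (-p) := Real.rpow_le_rpow_of_nonpos hy0 h (by linarith)
    have h3 := mul_le_mul_of_nonneg_right this (Real.rpow_pos_of_pos hy0 (-q)).le
    rw [← Real.rpow_add hy0, show -p + -q = -(p + q) by ring] at h3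
    linarith

/-- The three-way splitting, for abstract numbers. -/
lemma split_bound (w x y z ν s : ℝ) (hw : 1 ≤ w) (hx : 1 ≤ x) (hy : 1 ≤ y) (hz : 1 ≤ z)
    (h : w ≤ 3 * (x + y + z)) (hν0 : 0 < ν) (hν : ν < s) :
    x ^ (-ν) * y ^ (-s) * z ^ (-s) ≤ 9 ^ ν * w ^ (-ν) *
      (3 * (y ^ (-s) * z ^ (-s)) + x ^ (-s) * z ^ (-s) + x ^ (-s) * y ^ (-s)) := by
  have hw0 : 0 < w := by linarith
  have hx0 : 0 < x := by linarith
  have hy0 : 0 < y := by linarith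
  have hz0 : 0 < z := by linarith
  have key : ∀ t : ℝ, 1 ≤ t → w ≤ 9 * t → t ^ (-ν) ≤ 9 ^ ν * w ^ (-ν) := by
    intro t ht hwt
    have h1 : (9 * t) ^ (-ν) ≤ w ^ (-ν) := Real.rpow_le_rpow_of_nonpos hw0 hwt (by linarith)
    rw [Real.mul_rpow (by norm_num) (by linarith)] at h1
    have h9 : (0 : ℝ) < 9 ^ ν := Real.rpow_pos_of_pos (by norm_num) _
    have h2 := mul_le_mul_of_nonneg_left h1 h9.le
    rw [← mul_assoc, ← Real.rpow_add (by norm_num : (0 : ℝ) < 9)] at h2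
    simpa using h2
  have fac : ∀ t : ℝ, 0 < t → t ^ (-s) = t ^ (-ν) * t ^ (-(s - ν)) := by
    intro t ht
    rw [← Real.rpow_add ht]; congr 1; ring
  have px := Real.rpow_pos_of_pos hx0 (-s)
  have py := Real.rpow_pos_of_pos hy0 (-s)
  have pz := Real.rpow_pos_of_pos hz0 (-s)
  have pyz := mul_pos py pz
  have pxz := mul_pos px pz
  have pxy := mul_pos px py
  set D : ℝ := 9 ^ ν * w ^ (-ν) with hD
  have hD0 : 0 < D := mul_pos (Real.rpow_pos_of_pos (by norm_num) _) (Real.rpow_pos_of_pos hw0 _)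
  have hyoung : ∀ t : ℝ, 1 ≤ t → x ^ (-ν) * t ^ (-(s - ν)) ≤ x ^ (-s) + t ^ (-s) := by
    intro t ht
    have := young x t ν (s - ν) hx ht hν0.le (by linarith)
    simpa using this
  have cases3 : w ≤ 9 * x ∨ w ≤ 9 * y ∨ w ≤ 9 * z := by
    by_contra hc
    push Not at hc
    linarith [hc.1, hc.2.1, hc.2.2]
  rcases cases3 with hc | hc | hc
  · calc x ^ (-ν) * y ^ (-s) * z ^ (-s) = x ^ (-ν) * (y ^ (-s) * z ^ (-s)) := by ring
      _ ≤ D * (y ^ (-s) * z ^ (-s)) := mul_le_mul_of_nonneg_right (key x hx hc) pyz.le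
      _ ≤ _ := mul_le_mul_of_nonneg_left (by linarith) hD0.le
  · calc x ^ (-ν) * y ^ (-s) * z ^ (-s)
        = y ^ (-ν) * ((x ^ (-ν) * y ^ (-(s - ν))) * z ^ (-s)) := by rw [fac y hy0]; ring
      _ ≤ D * ((x ^ (-s) + y ^ (-s)) * z ^ (-s)) :=
          mul_le_mul (key y hy hc) (mul_le_mul_of_nonneg_right (hyoung y hy) pz.le)
            (by positivity) hD0.le
      _ ≤ _ := mul_le_mul_of_nonneg_left (by linarith) hD0.le
  · calc x ^ (-ν) * y ^ (-s) * z ^ (-s)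
        = z ^ (-ν) * ((x ^ (-ν) * z ^ (-(s - ν))) * y ^ (-s)) := by rw [fac z hz0]; ring
      _ ≤ D * ((x ^ (-s) + z ^ (-s)) * y ^ (-s)) :=
          mul_le_mul (key z hz hc) (mul_le_mul_of_nonneg_right (hyoung z hz) py.le)
            (by positivity) hD0.le
      _ ≤ _ := mul_le_mul_of_nonneg_left (by linarith) hD0.le

lemma exp_bound (a L τ : ℝ) (ha : 0 < a) (hL : 0 < L) (hτ : 0 < τ) :
    Real.exp (-2 * L * τ) ≤ a ^ a * τ ^ (-a) * L ^ (-a) := by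
  have hx : 0 < L * τ := mul_pos hL hτ
  have h1 : L * τ ≤ a * Real.exp (L * τ / a) := by
    have := Real.add_one_le_exp (L * τ / a)
    have h2 : L * τ / a ≤ Real.exp (L * τ / a) := by linarith
    rw [div_le_iff₀ ha] at h2
    linarith
  have h2 : (L * τ) ^ a ≤ a ^ a * Real.exp (L * τ) := by
    have := Real.rpow_le_rpow hx.le h1 ha.le
    rw [Real.mul_rpow ha.le (Real.exp_pos _).le, ← Real.exp_mul,
      div_mul_cancel₀ _ ha.ne'] at this
    exact this
  have h3 : Real.exp (-2 * L * τ) ≤ Real.exp (-(L * τ)) := Real.exp_le_exp.mpr (by nlinarith)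
  refine h3.trans ?_
  rw [mul_assoc, ← Real.mul_rpow hτ.le hL.le, mul_comm τ L, Real.rpow_neg hx.le, Real.exp_neg,
    ← div_eq_mul_inv, le_div_iff₀ (Real.rpow_pos_of_pos hx a), inv_mul_le_iff₀ (Real.exp_pos _)]
  linarith

/-- The involution `(i,k,l) ↦ (i,-i-k-l,l)`. -/
def flipK : ℤ × ℤ × ℤ ≃ ℤ × ℤ × ℤ where
  toFun p := (p.1, -p.1 - p.2.1 - p.2.2, p.2.2)
  invFun p := (p.1, -p.1 - p.2.1 - p.2.2, p.2.2)
  left_inv p := by ext <;> simp <;> ring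
  right_inv p := by ext <;> simp <;> ring

/-- The involution `(i,k,l) ↦ (i,k,-i-k-l)`. -/
def flipL : ℤ × ℤ × ℤ ≃ ℤ × ℤ × ℤ where
  toFun p := (p.1, p.2.1, -p.1 - p.2.1 - p.2.2)
  invFun p := (p.1, p.2.1, -p.1 - p.2.1 - p.2.2)
  left_inv p := by ext <;> simp <;> ring
  right_inv p := by ext <;> simp <;> ring

lemma summable_major (g f : ℤ → ℝ) (hg : Summable g) (hf : Summable f) (hg0 : ∀ n, 0 ≤ g n)
    (hf0 : ∀ n, 0 ≤ f n) :
    Summable (fun p : ℤ × ℤ × ℤ => g p.1 *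
      (3 * (f p.2.1 * f p.2.2) + f (-p.1 - p.2.1 - p.2.2) * f p.2.2
        + f (-p.1 - p.2.1 - p.2.2) * f p.2.1)) := by
  have h1 : Summable (fun p : ℤ × ℤ × ℤ => g p.1 * (f p.2.1 * f p.2.2)) :=
    hg.mul_of_nonneg (hf.mul_of_nonneg hf hf0 hf0) hg0
      (fun p => mul_nonneg (hf0 p.1) (hf0 p.2))
  have h2 := (flipK.summable_iff).mpr h1
  have h3 := (flipL.summable_iff).mpr h1
  refine (((h1.mul_left 3).add h2).add h3).congr ?_
  intro p
  simp only [Function.comp, flipK, flipL, Equiv.coe_fn_mk]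
  ring

/-- For `η > 1/4`, `0 < ν < 2η`, `ε > 0` and `a = 1/2 + 2η − ν + ε`, the constrained
sum `Σ_{i+j+k+l=0} λ_i^{2η} λ_j^{−ν} λ_k^{−2η} λ_l^{−2η} e^{−2λ_i τ}`
(parametrized by `(i,k,l) ∈ ℤ³` with `j = −i−k−l`) converges and is bounded by
`C τ^{−a}` uniformly for `τ ∈ (0,1]`. -/
theorem stmt19 (η ν ε : ℝ) (hη : 1 / 4 < η) (hν0 : 0 < ν) (hν : ν < 2 * η)
    (hε : 0 < ε) :
    ∃ C : ℝ, 0 < C ∧ ∀ τ : ℝ, 0 < τ → τ ≤ 1 →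
      Summable (fun p : ℤ × ℤ × ℤ =>
        lam p.1 ^ (2 * η) * lam (-p.1 - p.2.1 - p.2.2) ^ (-ν) *
          lam p.2.1 ^ (-(2 * η)) * lam p.2.2 ^ (-(2 * η)) *
          Real.exp (-2 * lam p.1 * τ)) ∧
      (∑' p : ℤ × ℤ × ℤ,
        lam p.1 ^ (2 * η) * lam (-p.1 - p.2.1 - p.2.2) ^ (-ν) *
          lam p.2.1 ^ (-(2 * η)) * lam p.2.2 ^ (-(2 * η)) *
          Real.exp (-2 * lam p.1 * τ)) ≤
        C * τ ^ (-(1 / 2 + 2 * η - ν + ε)) := by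
  have ha : 0 < 1 / 2 + 2 * η - ν + ε := by linarith
  set a : ℝ := 1 / 2 + 2 * η - ν + ε with hadef
  have hg := summable_lam (1 / 2 + ε) (by linarith)
  have hf := summable_lam (2 * η) (by linarith)
  have hpos : ∀ (n : ℤ) (s : ℝ), 0 ≤ lam n ^ s :=
    fun n s => (Real.rpow_pos_of_pos (lam_pos n) s).le
  have hM := summable_major _ _ hg hf (fun n => hpos n _) (fun n => hpos n _)
  set M : ℤ × ℤ × ℤ → ℝ := fun p => lam p.1 ^ (-(1 / 2 + ε)) *
      (3 * (lam p.2.1 ^ (-(2 * η)) * lam p.2.2 ^ (-(2 * η)))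
        + lam (-p.1 - p.2.1 - p.2.2) ^ (-(2 * η)) * lam p.2.2 ^ (-(2 * η))
        + lam (-p.1 - p.2.1 - p.2.2) ^ (-(2 * η)) * lam p.2.1 ^ (-(2 * η))) with hMdef
  have hM0 : ∀ p, 0 ≤ M p := by
    intro p
    have h1 := hpos p.1 (-(1 / 2 + ε))
    have h2 := hpos p.2.1 (-(2 * η))
    have h3 := hpos p.2.2 (-(2 * η))
    have h4 := hpos (-p.1 - p.2.1 - p.2.2) (-(2 * η))
    simp only [hMdef]
    positivity
  have hK : 0 < 9 ^ ν * a ^ a :=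
    mul_pos (Real.rpow_pos_of_pos (by norm_num) _) (Real.rpow_pos_of_pos ha _)
  have hT : 0 ≤ ∑' p, M p := tsum_nonneg hM0
  refine ⟨9 ^ ν * a ^ a * (∑' p, M p + 1), by positivity, ?_⟩
  intro τ hτ _
  have hτa : 0 < τ ^ (-a) := Real.rpow_pos_of_pos hτ _
  have hS := hM.mul_left (9 ^ ν * a ^ a * τ ^ (-a))
  have hle : ∀ p : ℤ × ℤ × ℤ, lam p.1 ^ (2 * η) * lam (-p.1 - p.2.1 - p.2.2) ^ (-ν) *
          lam p.2.1 ^ (-(2 * η)) * lam p.2.2 ^ (-(2 * η)) *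
          Real.exp (-2 * lam p.1 * τ) ≤ 9 ^ ν * a ^ a * τ ^ (-a) * M p := by
    rintro ⟨i, k, l⟩
    simp only [hMdef]
    have h1 := split_bound (lam i) (lam (-i - k - l)) (lam k) (lam l) ν (2 * η)
      (one_le_lam _) (one_le_lam _) (one_le_lam _) (one_le_lam _) (lam_sum_le i k l) hν0 hν
    have h2 := exp_bound a (lam i) τ ha (lam_pos i) hτ
    have h3 : lam i ^ (2 * η) * lam i ^ (-ν) * lam i ^ (-a) = lam i ^ (-(1 / 2 + ε)) := by
      rw [← Real.rpow_add (lam_pos i), ← Real.rpow_add (lam_pos i)]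
      congr 1; rw [hadef]; ring
    have hnn : 0 ≤ lam (-i - k - l) ^ (-ν) * lam k ^ (-(2 * η)) * lam l ^ (-(2 * η)) :=
      mul_nonneg (mul_nonneg (hpos _ _) (hpos _ _)) (hpos _ _)
    have h4 := mul_le_mul_of_nonneg_left
      (mul_le_mul h1 h2 (Real.exp_pos _).le (hnn.trans h1)) (hpos i (2 * η))
    rw [← h3]
    calc _ = _ := by ring
      _ ≤ _ := h4
      _ = _ := by ring
  have hsum := Summable.of_nonneg_of_le (fun p : ℤ × ℤ × ℤ => by
    have h1 := hpos p.1 (2 * η)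
    have h2 := hpos p.2.1 (-(2 * η))
    have h3 := hpos p.2.2 (-(2 * η))
    have h4 := hpos (-p.1 - p.2.1 - p.2.2) (-ν)
    exact mul_nonneg (mul_nonneg (mul_nonneg (mul_nonneg h1 h4) h2) h3) (Real.exp_pos _).le)
    hle hS
  refine ⟨hsum, (hsum.tsum_le_tsum hle hS).trans ?_⟩
  rw [tsum_mul_left]
  have := mul_pos hK hτa
  nlinarith
end
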